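/- Let n ≥ 5 and let S ∈ S_n satisfy R_n ⇒ S, with length sequence (l_1,…,l_n). If Σ_{i=1}^n l_i < n(n+1)/2, then S ∈ D_n; that is, the length sequence of S is not dominated by the length sequence of any code in S_n having a different length sequence. -/

import Mathlib

/-- A binary string is a `List Bool` (`false` = 0, `true` = 1).
A palindrome is a string equal to its own reversal. -/
def Palin (w : List Bool) : Prop := w.reverse = w

/-- A symmetric fix-free code: a finite set of binary palindromes in which
no element is a proper prefix of another. -/
def IsSFF (C : Finset (List Bool)) : Prop :=
  (∀ w ∈ C, Palin w) ∧ ∀ u ∈ C, ∀ w ∈ C, u <+: w → u = w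

/-- The sorted nondecreasing length sequence of a code. -/
def lenSeq (C : Finset (List Bool)) : List ℕ :=
  (C.val.map List.length).sort (· ≤ ·)

/-- The `i`-th entry (0-indexed) of the sorted length sequence. -/
def nthLen (C : Finset (List Bool)) (i : ℕ) : ℕ := (lenSeq C).getD i 0

/-- `p` is a probability vector with `p 0 ≥ p 1 ≥ ⋯ ≥ p (n-1) > 0`. -/
def IsProbVec (p : ℕ → ℝ) (n : ℕ) : Prop :=
  (∀ i j, i < n → j < n → i ≤ j → p j ≤ p i) ∧ (∀ i < n, 0 < p i) ∧
    ∑ i ∈ Finset.range n, p i = 1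

/-- Expected codeword length of `C` (via its sorted length sequence) under `p`. -/
noncomputable def expLen (p : ℕ → ℝ) (n : ℕ) (C : Finset (List Bool)) : ℝ :=
  ∑ i ∈ Finset.range n, p i * (nthLen C i : ℝ)

/-- `C` is an optimal symmetric fix-free code with `n` codewords: for some
nonincreasing probability vector, its expected length is minimal among all
symmetric fix-free codes with `n` codewords. -/
def IsOptimal (n : ℕ) (C : Finset (List Bool)) : Prop :=
  IsSFF C ∧ C.card = n ∧ ∃ p : ℕ → ℝ, IsProbVec p n ∧
    ∀ C' : Finset (List Bool), IsSFF C' → C'.card = n →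
      expLen p n C ≤ expLen p n C'

/-- Membership in `O_n`: optimal with `n` codewords and not containing the string `1`. -/
def InOpt (n : ℕ) (C : Finset (List Bool)) : Prop :=
  IsOptimal n C ∧ [true] ∉ C

/-- The root codeword `s i`: `s 1 = 0`, and `s i = 1 0^(i-2) 1` for `i ≥ 2`. -/
def rootWord (i : ℕ) : List Bool :=
  if i = 1 then [false] else true :: (List.replicate (i - 2) false ++ [true])

/-- The root code `R_n = {s_1, …, s_n}`. -/
def rootCode (n : ℕ) : Finset (List Bool) :=
  (Finset.Icc 1 n).image rootWord

/-- `N(σ)`: palindromes `w` such that `σ` is the longest palindrome that is a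
proper prefix of `w`. -/
def Nbhd (σ : List Bool) : Set (List Bool) :=
  {w | Palin w ∧ Palin σ ∧ σ <+: w ∧ σ ≠ w ∧
    ∀ u, Palin u → u <+: w → u ≠ w → u.length ≤ σ.length}

/-- `N_n(σ) = {w ∈ N(σ) : |w| ≤ n}`. -/
def NbhdN (n : ℕ) (σ : List Bool) : Set (List Bool) :=
  {w | w ∈ Nbhd σ ∧ w.length ≤ n}

/-- `S_n`: symmetric fix-free codes with `n` codewords, not containing `1`,
all of whose codewords have length at most `n`. -/
def SCodes (n : ℕ) : Set (Finset (List Bool)) :=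
  {C | IsSFF C ∧ C.card = n ∧ [true] ∉ C ∧ ∀ w ∈ C, w.length ≤ n}

/-- The relation `S →^σ T`: `σ ∈ S` and `T ⊆ (S ∪ N_n(σ)) \ {σ}`. -/
def ArrowTo (n : ℕ) (σ : List Bool) (S T : Finset (List Bool)) : Prop :=
  σ ∈ S ∧ ∀ w ∈ T, (w ∈ S ∨ w ∈ NbhdN n σ) ∧ w ≠ σ

/-- The relation `S ⇒^σ T`: `σ ∈ S`, `T ⊆ (S ∪ N_n(σ)) \ {σ}`, `|T| = n`, and
every omitted element of `(S ∪ N_n(σ)) \ {σ}` is at least as long as every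
element of `T` (so `T` consists of `n` shortest words of `(S ∪ N_n(σ)) \ {σ}`). -/
def StepTo (n : ℕ) (σ : List Bool) (S T : Finset (List Bool)) : Prop :=
  ArrowTo n σ S T ∧ T.card = n ∧
  ∀ w : List Bool, (w ∈ S ∨ w ∈ NbhdN n σ) → w ≠ σ → w ∉ T →
    ∀ v ∈ T, v.length ≤ w.length

/-- A `⇒`-transformation `R_n = S⁰ ⇒ S¹ ⇒ ⋯ ⇒ Sᵐ = C` of codes in `S_n`. -/
def IsTransform (n m : ℕ) (S : ℕ → Finset (List Bool)) (C : Finset (List Bool)) : Prop :=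
  S 0 = rootCode n ∧ S m = C ∧ (∀ i ≤ m, S i ∈ SCodes n) ∧
  ∀ i < m, ∃ σ, StepTo n σ (S i) (S (i + 1))

/-- A `⇒`-transformation with the witness `π i` used for the step `S i ⇒ S (i+1)`
(so `π 0, …, π (m-1)` are `π_1, …, π_m`). -/
def IsTransformW (n m : ℕ) (S : ℕ → Finset (List Bool)) (π : ℕ → List Bool)
    (C : Finset (List Bool)) : Prop :=
  S 0 = rootCode n ∧ S m = C ∧ (∀ i ≤ m, S i ∈ SCodes n) ∧
  ∀ i < m, StepTo n (π i) (S i) (S (i + 1))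

/-- `C^prefix`: palindromes other than `1` that are proper prefixes of some codeword of `C`. -/
def prefixSet (C : Finset (List Bool)) : Set (List Bool) :=
  {u | Palin u ∧ u ≠ [true] ∧ ∃ w ∈ C, u <+: w ∧ u ≠ w}

/-- Maximum codeword length of a code. -/
def maxLen (C : Finset (List Bool)) : ℕ := C.sup List.length

/-- Bitwise complement of a binary string. -/
def bcomp (w : List Bool) : List Bool := w.map (fun b => !b)

/-- `Dominates n l l'`: the sorted nondecreasing sequence `l` dominates `l'`,
i.e. `Σ_{j=1}^i l'_j ≥ Σ_{j=1}^i l_j` for every `i ∈ {1,…,n}`. -/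
def Dominates (n : ℕ) (l l' : ℕ → ℕ) : Prop :=
  ∀ i ≤ n, ∑ j ∈ Finset.range i, l j ≤ ∑ j ∈ Finset.range i, l' j

/-- Membership in `D_n`: codes in `S_n` whose length sequence is not dominated by
the length sequence of any code in `S_n` having a different length sequence. -/
def InD (n : ℕ) (S : Finset (List Bool)) : Prop :=
  S ∈ SCodes n ∧ ∀ C ∈ SCodes n, lenSeq C ≠ lenSeq S →
    ¬ Dominates n (nthLen C) (nthLen S)

/-- Number of words of length at most `m` in a code. -/
def cntLe (C : Finset (List Bool)) (m : ℕ) : ℕ := (C.filter (fun w => w.length ≤ m)).card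

theorem lenSeq_length (C : Finset (List Bool)) : (lenSeq C).length = C.card := by
  simp [lenSeq]

theorem sum_getD_list (f : ℕ → ℕ) (l : List ℕ) :
    ∑ j ∈ Finset.range l.length, f (l.getD j 0) = (l.map f).sum := by
  induction l with
  | nil => simp
  | cons a l ih =>
    rw [List.length_cons, Finset.sum_range_succ']
    simp only [List.getD_cons_succ, List.getD_cons_zero, List.map_cons, List.sum_cons]
    rw [ih, add_comm]

theorem sum_nthLen (f : ℕ → ℕ) (C : Finset (List Bool)) :
    ∑ j ∈ Finset.range C.card, f (nthLen C j) = ∑ w ∈ C, f w.length := by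
  unfold nthLen
  rw [← lenSeq_length, sum_getD_list, ← Multiset.sum_coe, ← Multiset.map_coe, lenSeq,
    Multiset.sort_eq, Multiset.map_map]
  rfl

theorem sum_cntLe (C : Finset (List Bool)) (M : ℕ) :
    ∑ w ∈ C, (M - w.length) = ∑ m ∈ Finset.range M, cntLe C m := by
  unfold cntLe
  simp_rw [Finset.card_filter]
  rw [Finset.sum_comm]
  refine Finset.sum_congr rfl fun w _ => ?_
  rw [← Finset.card_filter]
  have : (Finset.range M).filter (fun m => w.length ≤ m) = Finset.Ico w.length M := by
    ext; simp; omega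
  rw [this, Nat.card_Ico]

theorem nthLen_mono (C : Finset (List Bool)) {i j : ℕ} (hij : i ≤ j) (hj : j < C.card) :
    nthLen C i ≤ nthLen C j := by
  have hs : (lenSeq C).Pairwise (· ≤ ·) := by
    unfold lenSeq; exact Multiset.pairwise_sort _ _
  have hl := lenSeq_length C
  unfold nthLen
  rw [List.getD_eq_getElem _ _ (by omega), List.getD_eq_getElem _ _ (by omega)]
  rcases hij.lt_or_eq with h | h
  · exact List.pairwise_iff_getElem.1 hs i j _ _ h
  · subst h; exact le_rfl

/-- The key consequence of domination. -/
theorem dom_key (n : ℕ) (C S : Finset (List Bool)) (hC : C.card = n) (hS : S.card = n)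
    (hd : Dominates n (nthLen C) (nthLen S)) (M : ℕ) :
    ∑ m ∈ Finset.range M, cntLe S m ≤ ∑ m ∈ Finset.range M, cntLe C m := by
  rw [← sum_cntLe, ← sum_cntLe, ← sum_nthLen (fun x => M - x), ← sum_nthLen (fun x => M - x),
    hC, hS]
  -- find the threshold
  obtain ⟨t, htn, h1, h2⟩ : ∃ t ≤ n, (∀ j < t, nthLen S j ≤ M) ∧
      (∀ j, t ≤ j → j < n → M ≤ nthLen S j) := by
    by_cases h : ∃ j, j < n ∧ M ≤ nthLen S j
    · classical
      refine ⟨Nat.find h, (Nat.find_spec h).1.le, ?_, ?_⟩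
      · intro j hj
        have := Nat.find_min h hj
        have h3 := (Nat.find_spec h).1
        push Not at this
        exact (this (by omega)).le
      · intro j hj hjn
        exact (Nat.find_spec h).2.trans (nthLen_mono S hj (by omega))
    · push Not at h
      exact ⟨n, le_rfl, fun j hj => (h j hj).le, fun j h1 h2 => by omega⟩
  have hsplit : ∑ j ∈ Finset.range n, (M - nthLen S j) = ∑ j ∈ Finset.range t, (M - nthLen S j) := by
    symm
    refine Finset.sum_subset (by simpa using htn) ?_
    intro j hj hj'
    simp only [Finset.mem_range, not_lt] at hj hj'
    have := h2 j hj' hj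
    omega
  have hCs : ∑ j ∈ Finset.range t, (M - nthLen C j) ≤ ∑ j ∈ Finset.range n, (M - nthLen C j) :=
    Finset.sum_le_sum_of_subset (by simpa using htn)
  have e1 : ∑ j ∈ Finset.range t, (M - nthLen S j) + ∑ j ∈ Finset.range t, nthLen S j = t * M := by
    rw [← Finset.sum_add_distrib]
    rw [Finset.sum_congr rfl (g := fun _ => M)]
    · simp
    · intro j hj
      have := h1 j (by simpa using hj)
      omega
  have e2 : t * M ≤ ∑ j ∈ Finset.range t, (M - nthLen C j) + ∑ j ∈ Finset.range t, nthLen C j := by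
    rw [← Finset.sum_add_distrib]
    have : t * M = ∑ j ∈ Finset.range t, M := by simp
    rw [this]
    refine Finset.sum_le_sum fun j _ => by omega
  have := hd t htn
  omega

theorem lenSeq_eq_of_cntLe (C S : Finset (List Bool)) (h : ∀ m, cntLe C m = cntLe S m) :
    lenSeq C = lenSeq S := by
  have key : ∀ (D : Finset (List Bool)) (a : ℕ), cntLe D a =
      (D.val.map List.length).count a + (if a = 0 then 0 else cntLe D (a - 1)) := by
    intro D a
    rw [Multiset.count_map]
    have : (D.val.filter fun w => a = w.length).card
        = (D.filter fun w => a = w.length).card := rfl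
    rw [this]
    unfold cntLe
    split_ifs with ha
    · subst ha
      simp only [Nat.le_zero, add_zero]
      congr 1
      ext w
      simp only [Finset.mem_filter, eq_comm]
    · rw [← Finset.card_union_of_disjoint]
      · congr 1
        ext w; simp only [Finset.mem_filter, Finset.mem_union]
        constructor
        · rintro ⟨h1, h2⟩
          by_cases h3 : a = w.length
          · exact Or.inl ⟨h1, h3⟩
          · exact Or.inr ⟨h1, by omega⟩
        · rintro (⟨h1, h2⟩ | ⟨h1, h2⟩)
          · exact ⟨h1, by omega⟩
          · exact ⟨h1, by omega⟩
      · rw [Finset.disjoint_filter]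
        intro w _ h1 h2
        omega
  unfold lenSeq
  congr 1
  ext a
  have h1 := key C a
  have h2 := key S a
  rw [h a, h (a - 1)] at h1
  omega

theorem rootWord_length {j : ℕ} (hj : 1 ≤ j) : (rootWord j).length = j := by
  unfold rootWord
  split_ifs with h
  · simp [h]
  · simp; omega

theorem rootWord_palin (j : ℕ) : Palin (rootWord j) := by
  unfold rootWord Palin
  split_ifs with h <;> simp

theorem rootWord_getElem? {l p : ℕ} (hl : 2 ≤ l) (hp : p < l) :
    (rootWord l)[p]? = some (decide (p = 0 ∨ p = l - 1)) := by
  unfold rootWord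
  rw [if_neg (by omega)]
  rcases p with _ | p
  · simp
  · rw [List.getElem?_cons_succ]
    by_cases h : p = l - 2
    · subst h
      rw [List.getElem?_append_right (by simp)]
      simp; omega
    · rw [List.getElem?_append_left (by simp; omega)]
      rw [List.getElem?_replicate, if_pos (by omega)]
      simp; omega

theorem prefix_getElem? {u w : List Bool} (h : u <+: w) {p : ℕ} (hp : p < u.length) :
    w[p]? = u[p]? := by
  obtain ⟨t, rfl⟩ := h
  rw [List.getElem?_append_left hp]

theorem palin_getElem? {w : List Bool} (h : Palin w) {p : ℕ} (hp : p < w.length) :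
    w[p]? = w[w.length - 1 - p]? := by
  conv_lhs => rw [← (h : w.reverse = w)]
  rw [List.getElem?_reverse hp]

theorem exists_true_prefix (t : List Bool) (h : true ∈ t) :
    ∃ a, List.replicate a false ++ [true] <+: t := by
  induction t with
  | nil => simp at h
  | cons b t ih =>
    cases b
    · obtain ⟨a, ha⟩ := ih (by simpa using h)
      refine ⟨a + 1, ?_⟩
      rw [List.replicate_succ, List.cons_append]
      exact List.cons_prefix_cons.2 ⟨rfl, ha⟩
    · exact ⟨0, by simp⟩

theorem exists_root_prefix {w : List Bool} (hw : Palin w) (h0 : w ≠ []) (h1 : w ≠ [true]) :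
    ∃ j, 1 ≤ j ∧ rootWord j <+: w := by
  rcases w with _ | ⟨b, t⟩
  · exact absurd rfl h0
  · cases b
    · exact ⟨1, le_rfl, by simp [rootWord]⟩
    · have ht : t ≠ [] := by rintro rfl; exact h1 rfl
      have hm : true ∈ t := by
        have h2 : (true :: t).reverse = true :: t := hw
        have h3 : (true :: t).reverse.head? = some true := by rw [h2]; rfl
        rw [List.head?_reverse, List.getLast?_cons] at h3
        rw [List.getLast?_eq_some_getLast ht] at h3
        simp at h3
        rw [← h3]; exact List.getLast_mem ht
      obtain ⟨a, ha⟩ := exists_true_prefix t hm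
      refine ⟨a + 2, by omega, ?_⟩
      unfold rootWord
      rw [if_neg (by omega)]
      exact List.cons_prefix_cons.2 ⟨rfl, by simpa using ha⟩

theorem prefix_lt_length {u w : List Bool} (h : u <+: w) (hne : u ≠ w) : u.length < w.length := by
  rcases h.length_le.lt_or_eq with h1 | h1
  · exact h1
  · exact absurd (h.eq_of_length h1) hne

theorem ext_root_length {j : ℕ} (hj : 1 ≤ j) {w : List Bool} (hw : Palin w)
    (hp : rootWord j <+: w) (hne : rootWord j ≠ w) : 2 * j - 1 ≤ w.length := by
  by_contra hlt
  have hl := prefix_lt_length hp hne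
  rw [rootWord_length hj] at hl
  have h1 := prefix_getElem? hp (p := j - 1) (by rw [rootWord_length hj]; omega)
  have h2 := prefix_getElem? hp (p := w.length - j) (by rw [rootWord_length hj]; omega)
  rw [rootWord_getElem? (by omega) (by omega)] at h1 h2
  have h3 := palin_getElem? hw (p := j - 1) (by omega)
  rw [show w.length - 1 - (j - 1) = w.length - j by omega, h1, h2] at h3
  have h4 := (decide_eq_decide.1 (Option.some.inj h3)).1 (Or.inr rfl)
  omega

theorem palin_ext_unique {j : ℕ} (hj : 1 ≤ j) {s v w : List Bool} (hs : s.length = j)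
    (hv : Palin v) (hw : Palin w)
    (hsv : s <+: v) (hsw : s <+: w) (hlv : v.length = 2 * j - 1) (hlw : w.length = 2 * j - 1) :
    v = w := by
  apply List.ext_getElem?
  intro p
  by_cases hp : p < j
  · rw [prefix_getElem? hsv (by omega), prefix_getElem? hsw (by omega)]
  · by_cases hp2 : p < 2 * j - 1
    · have e1 := palin_getElem? hv (p := p) (by omega)
      have e2 := palin_getElem? hw (p := p) (by omega)
      rw [e1, e2, hlv, hlw,
        prefix_getElem? hsv (by omega), prefix_getElem? hsw (by omega)]
    · rw [List.getElem?_eq_none (by omega), List.getElem?_eq_none (by omega)]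

theorem exists_nbhd {σ : List Bool} (hσ : Palin σ) (L : ℕ) :
    ∀ w : List Bool, w.length ≤ L → Palin w → σ <+: w → σ ≠ w → ∃ v ∈ Nbhd σ, v <+: w := by
  induction L with
  | zero =>
    intro w hL hw hp hne
    have := prefix_lt_length hp hne
    omega
  | succ L ih =>
    intro w hL hw hp hne
    by_cases h : ∀ u, Palin u → u <+: w → u ≠ w → u.length ≤ σ.length
    · exact ⟨w, ⟨hw, hσ, hp, hne, h⟩, List.prefix_rfl⟩
    · push Not at h
      obtain ⟨u, hu, huw, hune, hul⟩ := h
      have := prefix_lt_length huw hune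
      obtain ⟨v, hv, hvu⟩ := ih u (by omega) hu (List.prefix_of_prefix_length_le hp huw hul.le)
        (by rintro rfl; omega)
      exact ⟨v, hv, hvu.trans huw⟩

theorem root_not_prefix {i l : ℕ} (hi : 1 ≤ i) (hl : 1 ≤ l) (h : rootWord i <+: rootWord l) :
    i = l := by
  by_contra hne
  have hlen := h.length_le
  rw [rootWord_length hi, rootWord_length hl] at hlen
  have h1 := prefix_getElem? h (p := i - 1) (by rw [rootWord_length hi]; omega)
  rw [rootWord_getElem? (by omega) (by omega)] at h1
  by_cases hi1 : i = 1
  · subst hi1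
    simp [rootWord] at h1
  · rw [rootWord_getElem? (by omega) (by omega)] at h1
    have h4 := (decide_eq_decide.1 (Option.some.inj h1)).2 (Or.inr rfl)
    omega

/-- Two distinct short elements of `N(s_i)`. -/
theorem exists_two {i : ℕ} (hi : 1 ≤ i) : ∃ x y, x ∈ Nbhd (rootWord i) ∧ y ∈ Nbhd (rootWord i) ∧
    x ≠ y ∧ x.length ≤ 2 * i ∧ y.length ≤ 2 * i + 1 := by
  have hlen := rootWord_length hi
  have hpal := rootWord_palin i
  obtain ⟨b, t, hbt⟩ : ∃ b t, rootWord i = b :: t := by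
    rcases h : rootWord i with _ | ⟨b, t⟩
    · rw [h] at hlen; simp at hlen; omega
    · exact ⟨b, t, rfl⟩
  have hw1 : Palin (rootWord i ++ rootWord i) := by
    unfold Palin at *; rw [List.reverse_append, hpal]
  have hw2 : Palin (rootWord i ++ (!b) :: rootWord i) := by
    unfold Palin at *
    rw [List.reverse_append, List.reverse_cons, hpal]; simp
  have l1 : (rootWord i ++ rootWord i).length = 2 * i := by simp [hlen]; omega
  have l2 : (rootWord i ++ (!b) :: rootWord i).length = 2 * i + 1 := by simp [hlen]; omega
  obtain ⟨x, hx, hxw⟩ := exists_nbhd hpal _ _ le_rfl hw1 (List.prefix_append _ _)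
    (by intro h; have := congrArg List.length h; omega)
  obtain ⟨y, hy, hyw⟩ := exists_nbhd hpal _ _ le_rfl hw2 (List.prefix_append _ _)
    (by intro h; have := congrArg List.length h; omega)
  refine ⟨x, y, hx, hy, ?_, by rw [← l1]; exact hxw.length_le, by rw [← l2]; exact hyw.length_le⟩
  rintro rfl
  have hxl := prefix_lt_length hx.2.2.1 hx.2.2.2.1
  have e1 := prefix_getElem? hxw (p := i) (by omega)
  have e2 := prefix_getElem? hyw (p := i) (by omega)
  rw [← e2, List.getElem?_append_right (by omega), List.getElem?_append_right (by omega), hlen] at e1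
  simp [hbt] at e1

theorem mem_rootCode {n : ℕ} {w : List Bool} :
    w ∈ rootCode n ↔ ∃ j, (1 ≤ j ∧ j ≤ n) ∧ rootWord j = w := by
  simp [rootCode]

theorem rootWord_injOn : Set.InjOn rootWord {j | 1 ≤ j} := by
  intro a ha b hb h
  have := congrArg List.length h
  rwa [rootWord_length ha, rootWord_length hb] at this

/-- Words of `C` omitting the first root word `s_k`. -/
theorem cnt_sub {n k : ℕ} {C : Finset (List Bool)} (hC : C ∈ SCodes n) (hne : [] ∉ C) (hk : 1 ≤ k)
    (hlt : ∀ j, 1 ≤ j → j < k → rootWord j ∈ C) (hkC : rootWord k ∉ C) {w : List Bool} (hw : w ∈ C) :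
    (∃ j, 1 ≤ j ∧ j ≠ k ∧ rootWord j = w) ∨
    (∃ j, k ≤ j ∧ rootWord j <+: w ∧ rootWord j ≠ w ∧ j < w.length ∧ 2 * j - 1 ≤ w.length) := by
  obtain ⟨⟨hpal, hfix⟩, hcard, h1, hlen⟩ := hC
  obtain ⟨j, hj, hp⟩ := exists_root_prefix (hpal w hw) (by rintro rfl; exact hne hw)
    (by rintro rfl; exact h1 hw)
  by_cases hjw : rootWord j = w
  · refine Or.inl ⟨j, hj, ?_, hjw⟩
    rintro rfl
    exact hkC (hjw ▸ hw)
  · refine Or.inr ⟨j, ?_, hp, hjw, ?_, ext_root_length hj (hpal w hw) hp hjw⟩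
    · by_contra hjk
      exact hjw (hfix _ (hlt j hj (by omega)) _ hw hp)
    · have := prefix_lt_length hp hjw
      rwa [rootWord_length hj] at this

theorem card_roots {m k : ℕ} (hk : 1 ≤ k) :
    (((Finset.Icc 1 m).erase k).image rootWord).card + (if k ≤ m then 1 else 0) = m := by
  rw [Finset.card_image_of_injOn]
  · split_ifs with h
    · rw [Finset.card_erase_of_mem (by simp; omega)]; simp; omega
    · rw [Finset.erase_eq_of_notMem (by simp; omega)]; simp
  · intro a ha b hb h
    simp only [Finset.mem_coe, Finset.mem_erase, Finset.mem_Icc] at ha hb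
    exact rootWord_injOn ha.2.1 hb.2.1 h

theorem cnt_bound1 {n k m : ℕ} {C : Finset (List Bool)} (hC : C ∈ SCodes n) (hne : [] ∉ C)
    (hk : 1 ≤ k) (hlt : ∀ j, 1 ≤ j → j < k → rootWord j ∈ C) (hkC : rootWord k ∉ C)
    (hm : m ≤ k ∨ m ≤ 2 * k - 2) :
    cntLe C m + (if k ≤ m then 1 else 0) ≤ m := by
  conv_rhs => rw [← card_roots (m := m) hk]
  gcongr
  unfold cntLe
  apply Finset.card_le_card
  intro w hw
  rw [Finset.mem_filter] at hw
  rcases cnt_sub hC hne hk hlt hkC hw.1 with ⟨j, h1, h2, h3⟩ | ⟨j, h1, h2, h3, h4, h5⟩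
  · simp only [Finset.mem_image, Finset.mem_erase, Finset.mem_Icc]
    refine ⟨j, ⟨h2, h1, ?_⟩, h3⟩
    have := congrArg List.length h3
    rw [rootWord_length h1] at this
    omega
  · omega

theorem cnt_bound2 {n k : ℕ} {C : Finset (List Bool)} (hC : C ∈ SCodes n) (hne : [] ∉ C)
    (hk : 1 ≤ k) (hlt : ∀ j, 1 ≤ j → j < k → rootWord j ∈ C) (hkC : rootWord k ∉ C) :
    cntLe C (2 * k - 1) ≤ 2 * k - 1 := by
  have hroots := card_roots (m := 2 * k - 1) hk
  rw [if_pos (by omega)] at hroots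
  set R := ((Finset.Icc 1 (2 * k - 1)).erase k).image rootWord with hR
  have hmain : ∀ w ∈ C, w.length ≤ 2 * k - 1 → w ∉ R → rootWord k <+: w ∧ w.length = 2 * k - 1 := by
    intro w hw hwl hwR
    rcases cnt_sub hC hne hk hlt hkC hw with ⟨j, h1, h2, h3⟩ | ⟨j, h1, h2, h3, h4, h5⟩
    · exfalso
      apply hwR
      simp only [hR, Finset.mem_image, Finset.mem_erase, Finset.mem_Icc]
      refine ⟨j, ⟨h2, h1, ?_⟩, h3⟩
      have := congrArg List.length h3
      rw [rootWord_length h1] at this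
      omega
    · have : j = k := by omega
      subst this
      exact ⟨h2, by omega⟩
  have hsd : ((C.filter (fun w => w.length ≤ 2 * k - 1)) \ R).card ≤ 1 := by
    rw [Finset.card_le_one]
    intro v hv w hw
    simp only [Finset.mem_sdiff, Finset.mem_filter] at hv hw
    obtain ⟨a1, a2⟩ := hmain v hv.1.1 hv.1.2 hv.2
    obtain ⟨b1, b2⟩ := hmain w hw.1.1 hw.1.2 hw.2
    exact palin_ext_unique hk (rootWord_length hk) (hC.1.1 v hv.1.1) (hC.1.1 w hw.1.1) a1 b1 a2 b2
  have := Finset.card_le_card_sdiff_add_card (t := R)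
    (s := C.filter (fun w => w.length ≤ 2 * k - 1))
  unfold cntLe
  omega

/-- Either all words are counted or all short candidates are in `S`. -/
theorem step_full {n m : ℕ} {σ : List Bool} {R S : Finset (List Bool)} (h : StepTo n σ R S)
    (hm : cntLe S m < n) {w : List Bool} (hw : w ∈ R ∨ w ∈ NbhdN n σ) (hne : w ≠ σ)
    (hwm : w.length ≤ m) : w ∈ S := by
  by_contra hwS
  have h3 := h.2.2 w hw hne hwS
  have : S.filter (fun w => w.length ≤ m) = S := by
    apply Finset.filter_true_of_mem
    intro v hv
    exact (h3 v hv).trans hwm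
  unfold cntLe at hm
  rw [this, h.2.1] at hm
  omega

theorem step_lower {n m i : ℕ} {S : Finset (List Bool)} (hi : 1 ≤ i)
    (h : StepTo n (rootWord i) (rootCode n) S) (hm : m < n) :
    m + (if 2 * i ≤ m then 1 else 0) + (if 2 * i + 1 ≤ m then 1 else 0) ≤
      cntLe S m + (if i ≤ m then 1 else 0) := by
  by_cases hc : cntLe S m < n
  swap
  · split_ifs <;> omega
  obtain ⟨x, y, hx, hy, hxy, hxl, hyl⟩ := exists_two hi
  have hroots := card_roots (m := m) hi
  set R := ((Finset.Icc 1 m).erase i).image rootWord with hR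
  have hRS : R ⊆ S.filter (fun w => w.length ≤ m) := by
    intro w hw
    simp only [hR, Finset.mem_image, Finset.mem_erase, Finset.mem_Icc] at hw
    obtain ⟨j, ⟨h1, h2, h3⟩, rfl⟩ := hw
    have hl := rootWord_length h2
    rw [Finset.mem_filter]
    refine ⟨step_full h hc (Or.inl (mem_rootCode.2 ⟨j, ⟨h2, by omega⟩, rfl⟩)) ?_ (by omega), by omega⟩
    intro he
    exact h1 (rootWord_injOn h2 hi he)
  have hN : ∀ z ∈ Nbhd (rootWord i), z ∉ R := by
    intro z hz hzR
    simp only [hR, Finset.mem_image, Finset.mem_erase, Finset.mem_Icc] at hzR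
    obtain ⟨j, ⟨h1, h2, h3⟩, rfl⟩ := hzR
    exact h1 (root_not_prefix hi h2 hz.2.2.1).symm
  have hNS : ∀ z ∈ Nbhd (rootWord i), z.length ≤ m → z ∈ S.filter (fun w => w.length ≤ m) := by
    intro z hz hzl
    rw [Finset.mem_filter]
    exact ⟨step_full h hc (Or.inr ⟨hz, by omega⟩) (Ne.symm hz.2.2.2.1) hzl, hzl⟩
  have c1 := Finset.card_le_card hRS
  unfold cntLe
  by_cases h1 : 2 * i + 1 ≤ m
  · have hs : insert x (insert y R) ⊆ S.filter (fun w => w.length ≤ m) :=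
      Finset.insert_subset (hNS x hx (by omega)) (Finset.insert_subset (hNS y hy (by omega)) hRS)
    have := Finset.card_le_card hs
    rw [Finset.card_insert_of_notMem, Finset.card_insert_of_notMem (hN y hy)] at this
    · split_ifs at * <;> omega
    · simp [hxy, hN x hx]
  · by_cases h2 : 2 * i ≤ m
    · have hs : insert x R ⊆ S.filter (fun w => w.length ≤ m) :=
        Finset.insert_subset (hNS x hx (by omega)) hRS
      have := Finset.card_le_card hs
      rw [Finset.card_insert_of_notMem (hN x hx)] at this
      split_ifs at * <;> omega
    · split_ifs at * <;> omega

theorem sum_ind (a M : ℕ) : ∑ m ∈ Finset.range M, (if a ≤ m then 1 else 0) = M - a := by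
  rw [← Finset.card_filter]
  have : (Finset.range M).filter (fun m => a ≤ m) = Finset.Ico a M := by
    ext; simp; omega
  rw [this, Nat.card_Ico]

/-- If `σ ∉ C` and `C` dominates `S`, then the length counts agree. -/
theorem case_notMem {n i : ℕ} {C S : Finset (List Bool)} (hC : C ∈ SCodes n) (hne : [] ∉ C)
    (hi : 1 ≤ i) (h : StepTo n (rootWord i) (rootCode n) S)
    (hd : Dominates n (nthLen C) (nthLen S)) (hiC : rootWord i ∉ C) :
    ∀ m, cntLe C m = cntLe S m := by
  have hScard : S.card = n := h.2.1
  obtain ⟨⟨hpal, hfix⟩, hcard, h1, hlen⟩ := hC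
  intro m
  induction m using Nat.strong_induction_on with
  | _ m ih =>
    rcases lt_trichotomy (cntLe C m) (cntLe S m) with hlt | heq | hgt
    · exfalso
      have hk := dom_key n C S hcard hScard hd (m + 1)
      rw [Finset.sum_range_succ, Finset.sum_range_succ] at hk
      have : ∑ x ∈ Finset.range m, cntLe C x = ∑ x ∈ Finset.range m, cntLe S x :=
        Finset.sum_congr rfl (fun x hx => ih x (by simpa using hx))
      omega
    · exact heq
    · exfalso
      have hCn : cntLe C m ≤ n := by
        rw [← hcard]; exact Finset.card_filter_le _ _
      have hSn : cntLe S m < n := by omega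
      have hsub : ∀ m' ≤ m, C.filter (fun w => w.length ≤ m') ⊆ S.filter (fun w => w.length ≤ m') := by
        intro m'
        induction m' using Nat.strong_induction_on with
        | _ m' ih' =>
          intro hm' w hw
          rw [Finset.mem_filter] at hw
          -- a prefix of `w` among the candidates
          obtain ⟨v, hv, hvne, hvw⟩ : ∃ v, (v ∈ rootCode n ∨ v ∈ NbhdN n (rootWord i)) ∧
              v ≠ rootWord i ∧ v <+: w := by
            obtain ⟨j, hj, hp⟩ := exists_root_prefix (hpal w hw.1)
              (by rintro rfl; exact hne hw.1) (by rintro rfl; exact h1 hw.1)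
            have hln := hlen w hw.1
            by_cases hji : j = i
            · subst hji
              obtain ⟨v, hv, hvw⟩ := exists_nbhd (rootWord_palin j) _ w le_rfl (hpal w hw.1) hp
                (by rintro rfl; exact hiC hw.1)
              exact ⟨v, Or.inr ⟨hv, hvw.length_le.trans hln⟩, Ne.symm hv.2.2.2.1, hvw⟩
            · refine ⟨rootWord j, Or.inl (mem_rootCode.2 ⟨j, ⟨hj, ?_⟩, rfl⟩), ?_, hp⟩
              · have := hp.length_le
                rw [rootWord_length hj] at this
                omega
              · intro he
                exact hji (rootWord_injOn hj hi he)
          have hvl := hvw.length_le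
          have hvS : v ∈ S := step_full h hSn hv hvne (by omega)
          have hvw' : v = w := by
            by_contra hvw'
            have hlt := prefix_lt_length hvw hvw'
            have hs := ih' (w.length - 1) (by omega) (by omega)
            have he : C.filter (fun u => u.length ≤ w.length - 1)
                = S.filter (fun u => u.length ≤ w.length - 1) := by
              apply Finset.eq_of_subset_of_card_le hs
              exact (ih (w.length - 1) (by omega)).ge
            have hvC : v ∈ C.filter (fun u => u.length ≤ w.length - 1) := by
              rw [he, Finset.mem_filter]
              exact ⟨hvS, by omega⟩
            exact hvw' (hfix v (Finset.mem_filter.1 hvC).1 w hw.1 hvw)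
          subst hvw'
          exact Finset.mem_filter.2 ⟨hvS, hw.2⟩
      have := Finset.card_le_card (hsub m le_rfl)
      unfold cntLe at hgt
      omega

/-- Let `n ≥ 5` and `S ∈ S_n` with `R_n ⇒ S`. If the total codeword
length of `S` is less than `n(n+1)/2`, then `S ∈ D_n`: the length sequence of
`S` is not dominated by the length sequence of any code in `S_n` with a
different length sequence. -/
theorem one_step_dominant (n : ℕ) (hn : 5 ≤ n) (S : Finset (List Bool))
    (hS : S ∈ SCodes n) (σ : List Bool) (hstep : StepTo n σ (rootCode n) S)
    (hsum : ∑ j ∈ Finset.range n, nthLen S j < n * (n + 1) / 2) :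
    InD n S := by
  refine ⟨hS, fun C hC hneq hd => ?_⟩
  obtain ⟨i, ⟨hi, hin⟩, rfl⟩ := mem_rootCode.1 hstep.1.1
  have hScard : S.card = n := hstep.2.1
  have hCcard : C.card = n := hC.2.1
  have hne : [] ∉ C := by
    intro h0
    have : C.card ≤ 1 := by
      rw [Finset.card_le_one]
      intro a ha b hb
      rw [← hC.1.2 _ h0 a ha (List.nil_prefix), ← hC.1.2 _ h0 b hb (List.nil_prefix)]
    omega
  by_cases hiC : rootWord i ∈ C
  swap
  · exact hneq (lenSeq_eq_of_cntLe _ _ (case_notMem hC hne hi hstep hd hiC))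
  have hkey := dom_key n C S hCcard hScard hd
  -- the first omitted root word
  have hex : ∃ k, 1 ≤ k ∧ rootWord k ∉ C := by
    refine ⟨n + 1, by omega, fun hmem => ?_⟩
    have := hC.2.2.2 _ hmem
    rw [rootWord_length (by omega)] at this
    omega
  obtain ⟨k, hk, hkC, hlt⟩ : ∃ k, 1 ≤ k ∧ rootWord k ∉ C ∧
      ∀ j, 1 ≤ j → j < k → rootWord j ∈ C := by
    classical
    refine ⟨Nat.find hex, (Nat.find_spec hex).1, (Nat.find_spec hex).2, ?_⟩
    intro j hj hjk
    have := Nat.find_min hex hjk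
    by_contra hjC
    exact this ⟨hj, hjC⟩
  have hki : k ≠ i := by rintro rfl; exact hkC hiC
  have hb2 := cnt_bound2 hC hne hk hlt hkC
  by_cases hlt_ki : k < i
  · have h1 := hkey (k + 1)
    have hSm : ∑ m ∈ Finset.range (k + 1), m ≤ ∑ m ∈ Finset.range (k + 1), cntLe S m := by
      refine Finset.sum_le_sum fun m hm => ?_
      rw [Finset.mem_range] at hm
      have := step_lower hi hstep (m := m) (by omega)
      rw [if_neg (by omega), if_neg (by omega), if_neg (by omega)] at this
      omega
    have hCm : ∑ m ∈ Finset.range (k + 1), (cntLe C m + if k ≤ m then 1 else 0) ≤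
        ∑ m ∈ Finset.range (k + 1), m := by
      refine Finset.sum_le_sum fun m hm => ?_
      rw [Finset.mem_range] at hm
      exact cnt_bound1 hC hne hk hlt hkC (Or.inl (by omega))
    rw [Finset.sum_add_distrib, sum_ind] at hCm
    omega
  have hik : i < k := by omega
  have hCb : ∀ m ≤ 2 * k - 1, cntLe C m + (if k ≤ m then 1 else 0) ≤
      m + (if 2 * k - 1 ≤ m then 1 else 0) := by
    intro m hm
    by_cases hm2 : m = 2 * k - 1
    · subst hm2
      rw [if_pos (by omega), if_pos (by omega)]
      omega
    · have := cnt_bound1 hC hne hk hlt hkC (m := m) (Or.inr (by omega))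
      omega
  by_cases h2k : 2 * k ≤ n
  · have h1 := hkey (2 * k)
    have hSm : ∑ m ∈ Finset.range (2 * k), (m + (if 2 * i ≤ m then 1 else 0) +
        (if 2 * i + 1 ≤ m then 1 else 0)) ≤
        ∑ m ∈ Finset.range (2 * k), (cntLe S m + if i ≤ m then 1 else 0) := by
      refine Finset.sum_le_sum fun m hm => ?_
      rw [Finset.mem_range] at hm
      exact step_lower hi hstep (by omega)
    have hCm : ∑ m ∈ Finset.range (2 * k), (cntLe C m + if k ≤ m then 1 else 0) ≤
        ∑ m ∈ Finset.range (2 * k), (m + if 2 * k - 1 ≤ m then 1 else 0) := by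
      refine Finset.sum_le_sum fun m hm => ?_
      rw [Finset.mem_range] at hm
      exact hCb m (by omega)
    simp only [Finset.sum_add_distrib, sum_ind] at hSm hCm
    omega
  · -- `C` does no better than the root code
    have hCm : ∑ m ∈ Finset.range n, cntLe C m ≤ ∑ m ∈ Finset.range n, m := by
      refine Finset.sum_le_sum fun m hm => ?_
      rw [Finset.mem_range] at hm
      have := hCb m (by omega)
      split_ifs at this <;> omega
    have hP := hd n le_rfl
    have hPC := sum_nthLen (fun x => x) C
    rw [hCcard] at hPC
    rw [← sum_cntLe] at hCm
    have e : ∑ w ∈ C, (n - w.length) + ∑ w ∈ C, w.length = n * n := by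
      rw [← Finset.sum_add_distrib, Finset.sum_congr rfl (g := fun _ => n)]
      · simp [hCcard]
      · intro w hw
        have := hC.2.2.2 w hw
        omega
    have hg : (∑ m ∈ Finset.range n, m) * 2 = n * (n - 1) := Finset.sum_range_id_mul_two n
    have hnn : n * (n - 1) + n * (n + 1) = 2 * (n * n) := by
      obtain ⟨r, rfl⟩ : ∃ r, n = r + 1 := ⟨n - 1, by omega⟩
      simp; ring
    omega
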